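/- Let s ≥ 1 be an integer and let Γ be a simplicial complex on a finite nonempty vertex set V. Suppose there is a vertex x ∈ V that is contained in no face of Γ of cardinality s+1 (i.e., x lies in no s-dimensional face). Then Σ_{B} (−1)^{|B|} = 0, where the sum runs over all subsets B ⊆ V such that dim Γ_B < s and dim Γ_{V∖B} < s. (Equivalently, the Euler character satisfies ζ̄_s ζ_s(Γ) = ε(Γ).) -/

import Mathlib

open Finset

/-- `Γ` is an (abstract) simplicial complex on the vertex type `V`: a collection of finite
subsets of `V` closed under taking subsets and containing every singleton. -/
def IsSimplicialComplex {V : Type*} (Γ : Finset (Finset V)) : Prop :=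
  (∀ X ∈ Γ, ∀ Y ⊆ X, Y ∈ Γ) ∧ ∀ v : V, {v} ∈ Γ

/-- The dimension of a simplicial complex, as an integer: one less than the maximal
cardinality of a face. -/
def dimSC {V : Type*} (Γ : Finset (Finset V)) : ℤ :=
  ((Γ.sup Finset.card : ℕ) : ℤ) - 1

/-- The induced simplicial complex `Γ_T`, whose faces are `{X ∩ T : X ∈ Γ}`. -/
def inducedSC {V : Type*} [DecidableEq V] (Γ : Finset (Finset V)) (T : Finset V) :
    Finset (Finset V) :=
  Γ.image (fun X => X ∩ T)

theorem dimSC_inducedSC_lt_iff {V : Type*} [DecidableEq V] {Γ : Finset (Finset V)}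
    (hΓ : IsSimplicialComplex Γ) (s : ℕ) (T : Finset V) :
    dimSC (inducedSC Γ T) < (s : ℤ) ↔ ∀ X ∈ Γ, X ⊆ T → X.card ≠ s + 1 := by
  have h : dimSC (inducedSC Γ T) < (s : ℤ) ↔ (inducedSC Γ T).sup Finset.card ≤ s := by
    unfold dimSC
    omega
  rw [h, Finset.sup_le_iff]
  simp only [inducedSC, Finset.mem_image, forall_exists_index, and_imp, forall_apply_eq_imp_iff₂]
  constructor
  · intro h X hX hXT hc
    have := h X hX
    rw [Finset.inter_eq_left.mpr hXT] at this
    omega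
  · intro h X hX
    by_contra! hc
    obtain ⟨Y, hY, hYc⟩ := Finset.exists_subset_card_eq (Nat.succ_le_of_lt hc)
    exact h Y (hΓ.1 X hX Y (hY.trans Finset.inter_subset_left))
      (hY.trans Finset.inter_subset_right) hYc

theorem dimSC_inducedSC_lt_of_agree {V : Type*} [DecidableEq V] {Γ : Finset (Finset V)}
    (hΓ : IsSimplicialComplex Γ) {s : ℕ} {x : V} (hx : ∀ X ∈ Γ, x ∈ X → X.card ≠ s + 1)
    {T T' : Finset V} (hT : ∀ y, y ≠ x → y ∈ T' → y ∈ T)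
    (h : dimSC (inducedSC Γ T) < (s : ℤ)) : dimSC (inducedSC Γ T') < (s : ℤ) := by
  rw [dimSC_inducedSC_lt_iff hΓ] at h ⊢
  intro X hX hXT
  by_cases hxX : x ∈ X
  · exact hx X hX hxX
  · exact h X hX fun y hy => hT y (fun e => hxX (e ▸ hy)) (hXT hy)

theorem stmt14 {V : Type*} [Fintype V] [DecidableEq V] [Nonempty V]
    (Γ : Finset (Finset V)) (hΓ : IsSimplicialComplex Γ) (s : ℕ) (hs : 1 ≤ s)
    (x : V) (hx : ∀ X ∈ Γ, x ∈ X → X.card ≠ s + 1) :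
    ∑ B ∈ (Finset.univ : Finset V).powerset.filter
        (fun B => dimSC (inducedSC Γ B) < (s : ℤ) ∧
          dimSC (inducedSC Γ (Finset.univ \ B)) < (s : ℤ)),
      (-1 : ℤ) ^ B.card = 0 := by
  refine Finset.sum_involution (fun B _ => if x ∈ B then B.erase x else insert x B) ?_ ?_ ?_ ?_
  · intro B _
    by_cases hB : x ∈ B
    · simp only [hB, if_true]
      rw [← Finset.card_erase_add_one hB, pow_succ]
      ring
    · simp only [hB, if_false]
      rw [Finset.card_insert_of_notMem hB, pow_succ]
      ring
  · intro B _ _ h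
    by_cases hB : x ∈ B
    · simp [hB] at h
    · simp [hB] at h
  · intro B hB
    simp only [Finset.mem_filter, Finset.mem_powerset, Finset.subset_univ, true_and] at hB ⊢
    refine ⟨dimSC_inducedSC_lt_of_agree hΓ hx ?_ hB.1, dimSC_inducedSC_lt_of_agree hΓ hx ?_ hB.2⟩
    · intro y hy
      split_ifs <;> simp [hy]
    · intro y hy
      split_ifs <;> simp [hy]
  · intro B _
    by_cases hB : x ∈ B <;> simp [hB]
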